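/- arXiv:1208.2856 — 2 statements merged into one kernel-verified Lean document; each statement's English description precedes it below -/
import Mathlib

section
/- For every n ≥ 1, the abelian complexity function ρ of the ordinary paperfolding word satisfies ρ(4n) = ρ(2n). -/
/-- The ordinary paperfolding word over `{0,1}`, indexed from 1:
writing `n = n' * 2^k` with `n'` odd, `pf n = 0` if `n' ≡ 1 (mod 4)`
and `pf n = 1` if `n' ≡ 3 (mod 4)`.  (The value at `0` is irrelevant.) -/
def pf (n : ℕ) : ℕ := if (n / 2 ^ (n.factorization 2)) % 4 = 1 then 0 else 1

/-- The factor `f_i f_{i+1} ⋯ f_{i+n-1}` of the paperfolding word,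
of length `n`, starting at position `i`. -/
def pfFactor (i n : ℕ) : List ℕ := (List.range n).map (fun j => pf (i + j))

/-- `w` is a factor of the ordinary paperfolding word. -/
def IsPFFactor (w : List ℕ) : Prop := ∃ i : ℕ, 1 ≤ i ∧ w = pfFactor i w.length

/-- The abelian complexity function of the ordinary paperfolding word:
the number of abelian equivalence classes of factors of length `n`,
where the class of a factor `w` is determined by the pair
`(|w|_0, |w|_1)` of numbers of occurrences of `0` and `1` in `w`. -/
noncomputable def ρ (n : ℕ) : ℕ :=
  {p : ℕ × ℕ | ∃ i : ℕ, 1 ≤ i ∧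
    p = ((pfFactor i n).count 0, (pfFactor i n).count 1)}.ncard

/-- `Δ w = |w|_0 - |w|_1`. -/
def Δ (w : List ℕ) : ℤ := (w.count 0 : ℤ) - (w.count 1 : ℤ)

/-- `M n` is the maximum of `Δ w` over all factors `w` of the
paperfolding word of length `n`. -/
noncomputable def M (n : ℕ) : ℤ :=
  sSup {d : ℤ | ∃ i : ℕ, 1 ≤ i ∧ d = Δ (pfFactor i n)}

theorem pf_two_mul (k : ℕ) : pf (2 * k) = pf k := by
  rcases Nat.eq_zero_or_pos k with rfl | hk
  · rfl
  · have h : (2 * k).factorization 2 = k.factorization 2 + 1 := by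
      rw [Nat.factorization_mul (by norm_num) hk.ne', Finsupp.add_apply,
        Nat.prime_two.factorization_self, add_comm]
    rw [pf, pf, h, pow_succ', Nat.mul_div_mul_left _ _ two_pos]

theorem pf_of_mod_four_eq_one {k : ℕ} (h : k % 4 = 1) : pf k = 0 := by
  have h2 : k.factorization 2 = 0 := Nat.factorization_eq_zero_of_not_dvd (by omega)
  simp [pf, h2, h]

theorem pf_of_mod_four_eq_three {k : ℕ} (h : k % 4 = 3) : pf k = 1 := by
  have h2 : k.factorization 2 = 0 := Nat.factorization_eq_zero_of_not_dvd (by omega)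
  simp [pf, h2, h]

theorem pfFactor_succ (i n : ℕ) : pfFactor i (n + 1) = pfFactor i n ++ [pf (i + n)] := by
  simp [pfFactor, List.range_succ]

/-- Four consecutive letters consist of a `0` and a `1` at the odd positions, and of two
consecutive letters of the word itself at the even positions. -/
theorem perm_four_letters (m : ℕ) :
    [pf m, pf (m + 1), pf (m + 2), pf (m + 3)].Perm
      [pf ((m + 1) / 2), pf ((m + 1) / 2 + 1), 0, 1] := by
  obtain ⟨q, rfl | rfl | rfl | rfl⟩ :
      ∃ q, m = 4 * q ∨ m = 4 * q + 1 ∨ m = 4 * q + 2 ∨ m = 4 * q + 3 :=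
    ⟨m / 4, by omega⟩
  · rw [pf_of_mod_four_eq_one (k := 4 * q + 1) (by omega),
      pf_of_mod_four_eq_three (k := 4 * q + 3) (by omega),
      show 4 * q = 2 * (2 * q) by ring, show 2 * (2 * q) + 2 = 2 * (2 * q + 1) by ring,
      show (2 * (2 * q) + 1) / 2 = 2 * q by omega, pf_two_mul (2 * q), pf_two_mul (2 * q + 1)]
    exact (List.Perm.swap _ _ _).cons _
  · rw [pf_of_mod_four_eq_one (k := 4 * q + 1) (by omega),
      pf_of_mod_four_eq_three (k := 4 * q + 1 + 2) (by omega),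
      show 4 * q + 1 + 1 = 2 * (2 * q + 1) by ring,
      show 4 * q + 1 + 3 = 2 * (2 * q + 1 + 1) by ring,
      show 2 * (2 * q + 1) / 2 = 2 * q + 1 by omega, pf_two_mul (2 * q + 1),
      pf_two_mul (2 * q + 1 + 1)]
    rw [List.perm_iff_count]
    intro a
    simp only [List.count_cons, List.count_nil]
    omega
  · rw [pf_of_mod_four_eq_three (k := 4 * q + 2 + 1) (by omega),
      pf_of_mod_four_eq_one (k := 4 * q + 2 + 3) (by omega),
      show 4 * q + 2 = 2 * (2 * q + 1) by ring,
      show 2 * (2 * q + 1) + 2 = 2 * (2 * q + 1 + 1) by ring,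
      show (2 * (2 * q + 1) + 1) / 2 = 2 * q + 1 by omega, pf_two_mul (2 * q + 1),
      pf_two_mul (2 * q + 1 + 1)]
    rw [List.perm_iff_count]
    intro a
    simp only [List.count_cons, List.count_nil]
    omega
  · rw [pf_of_mod_four_eq_three (k := 4 * q + 3) (by omega),
      pf_of_mod_four_eq_one (k := 4 * q + 3 + 2) (by omega),
      show 4 * q + 3 + 1 = 2 * (2 * q + 2) by ring,
      show 4 * q + 3 + 3 = 2 * (2 * q + 2 + 1) by ring,
      show 2 * (2 * q + 2) / 2 = 2 * q + 2 by omega, pf_two_mul (2 * q + 2),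
      pf_two_mul (2 * q + 2 + 1)]
    rw [List.perm_iff_count]
    intro a
    simp only [List.count_cons, List.count_nil]
    omega

theorem count_pfFactor_four_mul {a : ℕ} (ha : a = 0 ∨ a = 1) (i n : ℕ) :
    (pfFactor i (4 * n)).count a = (pfFactor ((i + 1) / 2) (2 * n)).count a + n := by
  induction n with
  | zero => simp [pfFactor]
  | succ n ih =>
    have h := (perm_four_letters (i + 4 * n)).count_eq a
    rw [show (i + 4 * n + 1) / 2 = (i + 1) / 2 + 2 * n by omega] at h
    have h01 : [0, 1].count a = 1 := by rcases ha with rfl | rfl <;> rfl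
    rw [show 4 * (n + 1) = 4 * n + 1 + 1 + 1 + 1 by ring, show 2 * (n + 1) = 2 * n + 1 + 1 by ring]
    simp only [pfFactor_succ, List.count_append, ← add_assoc, ih]
    simp only [List.count_cons, List.count_nil] at h h01 ⊢
    omega

theorem pf_rho_four_mul : ∀ n : ℕ, 1 ≤ n → ρ (4 * n) = ρ (2 * n) := by
  intro n _
  have hinj : Function.Injective fun p : ℕ × ℕ => (p.1 + n, p.2 + n) := by
    rintro ⟨a, b⟩ ⟨c, d⟩ h
    simpa using h
  symm
  rw [ρ, ρ, ← Set.ncard_image_of_injective _ hinj]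
  congr 1
  ext p
  simp only [Set.mem_ofPred_eq, Set.mem_image]
  constructor
  · rintro ⟨_, ⟨j, hj, rfl⟩, rfl⟩
    refine ⟨2 * j, by omega, ?_⟩
    rw [count_pfFactor_four_mul (.inl rfl), count_pfFactor_four_mul (.inr rfl),
      show (2 * j + 1) / 2 = j by omega]
  · rintro ⟨i, hi, rfl⟩
    exact ⟨_, ⟨(i + 1) / 2, by omega, rfl⟩, by
      rw [count_pfFactor_four_mul (.inl rfl), count_pfFactor_four_mul (.inr rfl)]⟩
end

section
/- For every n ≥ 1, the abelian complexity function ρ of the ordinary paperfolding word satisfies ρ(n+1) = ρ(n) + 1 or ρ(n+1) = ρ(n) − 1. -/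
lemma pf_two_pow_mul (a m : ℕ) (hm : Odd m) :
    pf (2 ^ a * m) = if m % 4 = 1 then 0 else 1 := by
  have hfac : (2 ^ a * m).factorization 2 = a := by
    rw [Nat.factorization_mul (by positivity) hm.pos.ne', Nat.Prime.factorization_pow Nat.prime_two]
    simp [Nat.factorization_eq_zero_of_not_dvd hm.not_two_dvd_nat]
  rw [pf, hfac, Nat.mul_div_cancel_left _ (by positivity)]

lemma pf_le_one (n : ℕ) : pf n ≤ 1 := by
  unfold pf
  split_ifs <;> omega

/-- The prefix of length `2 ^ k - 1` is antisymmetric about its centre. -/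
lemma pf_add_pf_two_pow_sub {j k : ℕ} (hj : 1 ≤ j) (hjk : 2 * j < 2 ^ k) :
    pf j + pf (2 ^ k - j) = 1 := by
  obtain ⟨a, m, hm, rfl⟩ := Nat.exists_eq_two_pow_mul_odd (by omega : j ≠ 0)
  have hak : a + 1 < k := by
    refine (Nat.pow_lt_pow_iff_right (a := 2) (by omega)).1 (lt_of_le_of_lt ?_ hjk)
    rw [pow_succ']
    exact Nat.mul_le_mul_left 2 (Nat.le_mul_of_pos_right _ hm.pos)
  obtain ⟨b, rfl⟩ := Nat.exists_eq_add_of_le (show a + 2 ≤ k from hak)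
  have hpow : 2 ^ (a + 2 + b) = 2 ^ a * (4 * 2 ^ b) := by ring
  have hlt : m < 4 * 2 ^ b := by
    refine Nat.lt_of_mul_lt_mul_left (a := 2 ^ a) ?_
    omega
  have hodd : Odd (4 * 2 ^ b - m) := by
    rw [Nat.odd_iff] at *
    omega
  rw [hpow, ← Nat.mul_sub, pf_two_pow_mul _ _ hm, pf_two_pow_mul _ _ hodd]
  rw [Nat.odd_iff] at *
  split_ifs <;> omega

/-- The number of ones in the factor of length `n` starting at position `i`. -/
def pfOnes (i n : ℕ) : ℕ := (pfFactor i n).count 1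

lemma pf_eq_zero_or_one (n : ℕ) : pf n = 0 ∨ pf n = 1 := by
  have := pf_le_one n
  omega

lemma pfOnes_succ (i n : ℕ) : pfOnes i (n + 1) = pfOnes i n + pf (i + n) := by
  rcases pf_eq_zero_or_one (i + n) with h | h <;>
    simp [pfOnes, pfFactor, List.range_succ, h]

lemma pfOnes_succ' (i n : ℕ) : pfOnes i (n + 1) = pf i + pfOnes (i + 1) n := by
  induction n with
  | zero => rcases pf_eq_zero_or_one i with h | h <;> simp [pfOnes, pfFactor, h]
  | succ n ih =>
    rw [pfOnes_succ, ih, pfOnes_succ, add_right_comm i 1 n]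
    ring_nf

lemma pfFactor_count_zero (i n : ℕ) : (pfFactor i n).count 0 + pfOnes i n = n := by
  induction n with
  | zero => simp [pfOnes, pfFactor]
  | succ n ih =>
    rw [pfOnes_succ]
    rcases pf_eq_zero_or_one (i + n) with h | h <;>
      simp [pfFactor, List.range_succ, h] at ih ⊢ <;> omega

lemma pfOnes_reflect {i n k : ℕ} (hi : 1 ≤ i) (h : 2 * (i + n) ≤ 2 ^ k) :
    pfOnes i n + pfOnes (2 ^ k + 1 - i - n) n = n := by
  induction n with
  | zero => simp [pfOnes, pfFactor]
  | succ n ih =>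
    have hrefl := pf_add_pf_two_pow_sub (j := i + n) (k := k) (by omega) (by omega)
    have hn := ih (by omega)
    rw [show 2 ^ k + 1 - i - (n + 1) = 2 ^ k - (i + n) by omega, pfOnes_succ, pfOnes_succ',
      show 2 ^ k - (i + n) + 1 = 2 ^ k + 1 - i - n by omega]
    omega

/-- A sequence of naturals with steps of size at most one takes all intermediate values. -/
lemma exists_eq_of_steps_le_one {g : ℕ → ℕ} (hup : ∀ i, g (i + 1) ≤ g i + 1)
    (hdown : ∀ i, g i ≤ g (i + 1) + 1) {i k v : ℕ} (hik : i ≤ k)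
    (hv : g i ≤ v ∧ v ≤ g k ∨ g k ≤ v ∧ v ≤ g i) : ∃ j, i ≤ j ∧ g j = v := by
  induction k, hik using Nat.le_induction with
  | base => exact ⟨i, le_rfl, by omega⟩
  | succ k hik ih =>
    by_cases hk : g (k + 1) = v
    · exact ⟨k + 1, by omega, hk⟩
    · have := hup k
      have := hdown k
      exact ih (by omega)

/-- The numbers of ones occurring in factors of length `n`. -/
def pfOnesSet (n : ℕ) : Set ℕ := {c | ∃ i, 1 ≤ i ∧ pfOnes i n = c}

lemma pfOnesSet_nonempty (n : ℕ) : (pfOnesSet n).Nonempty := ⟨_, 1, le_rfl, rfl⟩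

lemma sub_mem_pfOnesSet {n c : ℕ} (hc : c ∈ pfOnesSet n) : c ≤ n ∧ n - c ∈ pfOnesSet n := by
  obtain ⟨i, hi, rfl⟩ := hc
  have hlt : 2 * (i + n) < 2 ^ (2 * (i + n)) := Nat.lt_two_pow_self
  have hrefl := pfOnes_reflect hi hlt.le
  exact ⟨by omega, 2 ^ (2 * (i + n)) + 1 - i - n, by omega, by omega⟩

lemma mem_pfOnesSet_of_between {n a b v : ℕ} (ha : a ∈ pfOnesSet n) (hb : b ∈ pfOnesSet n)
    (hav : a ≤ v) (hvb : v ≤ b) : v ∈ pfOnesSet n := by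
  obtain ⟨i, hi, rfl⟩ := ha
  obtain ⟨k, hk, rfl⟩ := hb
  have hstep : ∀ i, pfOnes i n + pf (i + n) = pf i + pfOnes (i + 1) n := fun i => by
    rw [← pfOnes_succ, pfOnes_succ']
  have hup : ∀ i, pfOnes (i + 1) n ≤ pfOnes i n + 1 := fun i => by
    have := hstep i
    have := pf_le_one (i + n)
    omega
  have hdown : ∀ i, pfOnes i n ≤ pfOnes (i + 1) n + 1 := fun i => by
    have := hstep i
    have := pf_le_one i
    omega
  rcases le_total i k with hik | hik
  · obtain ⟨j, hj, hjv⟩ := exists_eq_of_steps_le_one (g := (pfOnes · n)) hup hdown hik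
      (Or.inl ⟨hav, hvb⟩)
    exact ⟨j, by omega, hjv⟩
  · obtain ⟨j, hj, hjv⟩ := exists_eq_of_steps_le_one (g := (pfOnes · n)) hup hdown hik
      (Or.inr ⟨hav, hvb⟩)
    exact ⟨j, by omega, hjv⟩

lemma pfOnesSet_eq_Icc (n : ℕ) :
    pfOnesSet n = Set.Icc (sInf (pfOnesSet n)) (n - sInf (pfOnesSet n)) := by
  have hmin := Nat.sInf_mem (pfOnesSet_nonempty n)
  refine Set.Subset.antisymm (fun c hc => ⟨Nat.sInf_le hc, ?_⟩) fun c hc =>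
    mem_pfOnesSet_of_between hmin (sub_mem_pfOnesSet hmin).2 hc.1 hc.2
  have := Nat.sInf_le (sub_mem_pfOnesSet hc).2
  have := (sub_mem_pfOnesSet hc).1
  omega

lemma rho_eq_ncard_pfOnesSet (n : ℕ) : ρ n = (pfOnesSet n).ncard := by
  have himage : {p : ℕ × ℕ | ∃ i : ℕ, 1 ≤ i ∧
      p = ((pfFactor i n).count 0, (pfFactor i n).count 1)} =
      Set.image (fun c => (n - c, c)) (pfOnesSet n) := by
    ext p
    have hpair : ∀ i, ((pfFactor i n).count 0, (pfFactor i n).count 1) =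
        (n - pfOnes i n, pfOnes i n) := fun i => by
      have := pfFactor_count_zero i n
      exact Prod.ext (show _ = n - pfOnes i n by omega) rfl
    simp only [hpair, pfOnesSet, Set.mem_ofPred_eq, Set.mem_image]
    constructor
    · rintro ⟨i, hi, rfl⟩
      exact ⟨_, ⟨i, hi, rfl⟩, rfl⟩
    · rintro ⟨_, ⟨i, hi, rfl⟩, rfl⟩
      exact ⟨i, hi, rfl⟩
  rw [ρ, himage]
  exact Set.ncard_image_of_injective _ fun a b hab => (Prod.ext_iff.1 hab).2

lemma rho_add_two_mul_sInf (n : ℕ) : ρ n + 2 * sInf (pfOnesSet n) = n + 1 := by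
  have hmin := Nat.sInf_mem (pfOnesSet_nonempty n)
  have hle := (sub_mem_pfOnesSet hmin).1
  have hsub := Nat.sInf_le (sub_mem_pfOnesSet hmin).2
  rw [rho_eq_ncard_pfOnesSet]
  have hcard : (pfOnesSet n).ncard = n - sInf (pfOnesSet n) + 1 - sInf (pfOnesSet n) := by
    conv_lhs => rw [pfOnesSet_eq_Icc n]
    rw [← Finset.coe_Icc, Set.ncard_coe_finset, Nat.card_Icc]
  omega

lemma sInf_pfOnesSet_le_succ (n : ℕ) : sInf (pfOnesSet n) ≤ sInf (pfOnesSet (n + 1)) := by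
  obtain ⟨i, hi, hmin⟩ := Nat.sInf_mem (pfOnesSet_nonempty (n + 1))
  have hle : sInf (pfOnesSet n) ≤ pfOnes i n := Nat.sInf_le ⟨i, hi, rfl⟩
  rw [pfOnes_succ] at hmin
  omega

lemma sInf_pfOnesSet_succ_le (n : ℕ) : sInf (pfOnesSet (n + 1)) ≤ sInf (pfOnesSet n) + 1 := by
  obtain ⟨i, hi, hmin⟩ := Nat.sInf_mem (pfOnesSet_nonempty n)
  have hle : sInf (pfOnesSet (n + 1)) ≤ pfOnes i (n + 1) := Nat.sInf_le ⟨i, hi, rfl⟩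
  have := pf_le_one (i + n)
  rw [pfOnes_succ] at hle
  omega

/-- For `n ≥ 1`, `ρ(n+1) = ρ(n) + 1` or `ρ(n+1) = ρ(n) - 1`. -/
theorem pf_rho_succ : ∀ n : ℕ, 1 ≤ n →
    ρ (n + 1) = ρ n + 1 ∨ ρ (n + 1) + 1 = ρ n := by
  intro n _
  have := rho_add_two_mul_sInf n
  have := rho_add_two_mul_sInf (n + 1)
  have := sInf_pfOnesSet_le_succ n
  have := sInf_pfOnesSet_succ_le n
  omega
end
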